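/- arXiv:2006.03319 — 2 statements merged into one kernel-verified Lean document; each statement's English description precedes it below -/
import Mathlib

section
/- Compatibility of the modified pre-Iwasawa decomposition with the Möbius action: let M = [[a,b],[c,d]] ∈ Sp(n,ℝ) and v' = x' + iy' ∈ 𝒳ₙ. Define the real matrices A := c(y' + x'·y'^{-1}·x')cᵗ + d·y'^{-1}·dᵗ + c·x'·y'^{-1}·dᵗ + d·y'^{-1}·x'·cᵗ and N := c(y' + x'·y'^{-1}·x')aᵗ + c·x'·y'^{-1}·bᵗ + d·y'^{-1}·x'·aᵗ + d·y'^{-1}·bᵗ. Then A is invertible and A^{-1}(N + i·I) = (av' + b)(cv' + d)^{-1}. -/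
open Matrix

/-- The standard symplectic structure matrix `J` with `n×n` blocks `[[0, I],[−I, 0]]`. -/
def Jmat (n : ℕ) : Matrix (Fin n ⊕ Fin n) (Fin n ⊕ Fin n) ℝ :=
  fromBlocks 0 1 (-1) 0

/-- The blocks of a symplectic matrix satisfy the usual relations, on columns and on rows. -/
theorem symplectic_block_relations {n : ℕ} {a b c d : Matrix (Fin n) (Fin n) ℝ}
    (hM : (fromBlocks a b c d)ᵀ * Jmat n * fromBlocks a b c d = Jmat n) :
    (aᵀ * c = cᵀ * a ∧ bᵀ * d = dᵀ * b ∧ aᵀ * d - cᵀ * b = 1) ∧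
      (c * dᵀ = d * cᵀ ∧ d * aᵀ - c * bᵀ = 1) := by
  have hJ : Jmat n = -Matrix.J (Fin n) ℝ := by
    simp [Jmat, Matrix.J, fromBlocks_neg]
  have hmem : fromBlocks a b c d ∈ symplecticGroup (Fin n) ℝ := by
    rw [SymplecticGroup.mem_iff']
    simpa [hJ] using hM
  have hrow := SymplecticGroup.mem_iff.mp hmem
  simp only [Jmat, Matrix.J, fromBlocks_transpose, fromBlocks_multiply, fromBlocks_inj,
    mul_zero, mul_one, mul_neg, zero_add, add_zero, neg_mul] at hM hrow
  obtain ⟨h₁, h₂, h₃, h₄⟩ := hM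
  obtain ⟨k₁, k₂, k₃, k₄⟩ := hrow
  refine ⟨⟨?_, ?_, ?_⟩, ?_, ?_⟩
  · rw [← sub_eq_zero, ← h₁]; abel
  · rw [← sub_eq_zero, ← h₄]; abel
  · rw [← h₂]; abel
  · rw [← sub_eq_zero, ← neg_eq_zero, ← k₄]; abel
  · rw [← k₃]; abel

/-- A sum `B w Bᵀ + C y Cᵀ` with `w`, `y` positive definite is invertible as soon as
`Bᵀ` and `Cᵀ` have no common kernel. -/
theorem isUnit_add_of_posDef {m : Type*} [Fintype m] [DecidableEq m] {B C w y : Matrix m m ℝ}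
    (hw : w.PosDef) (hy : y.PosDef)
    (hker : ∀ u, Bᵀ *ᵥ u = 0 → Cᵀ *ᵥ u = 0 → u = 0) :
    IsUnit (B * w * Bᵀ + C * y * Cᵀ) := by
  rw [← mulVec_injective_iff_isUnit]
  refine (injective_iff_map_eq_zero (mulVecLin (B * w * Bᵀ + C * y * Cᵀ))).mpr fun u hu ↦ ?_
  have hsum : (Bᵀ *ᵥ u) ⬝ᵥ (w *ᵥ (Bᵀ *ᵥ u)) + (Cᵀ *ᵥ u) ⬝ᵥ (y *ᵥ (Cᵀ *ᵥ u)) = 0 := by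
    have h := congrArg (u ⬝ᵥ ·) hu
    simpa [add_mulVec, dotProduct_add, ← mulVec_mulVec, dotProduct_mulVec u,
      ← mulVec_transpose] using h
  have pos {z : Matrix m m ℝ} (hz : z.PosDef) (t : m → ℝ) (ht : t ≠ 0) : 0 < t ⬝ᵥ (z *ᵥ t) := by
    simpa using hz.dotProduct_mulVec_pos ht
  have nonneg {z : Matrix m m ℝ} (hz : z.PosDef) (t : m → ℝ) : 0 ≤ t ⬝ᵥ (z *ᵥ t) := by
    simpa using hz.posSemidef.dotProduct_mulVec_nonneg t
  refine hker u ?_ ?_ <;> by_contra h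
  · linarith [pos hw _ h, nonneg hy (Cᵀ *ᵥ u)]
  · linarith [pos hy _ h, nonneg hw (Bᵀ *ᵥ u)]

theorem sub_I_smul_mul_mul_add_I_smul {m : Type*} [Fintype m] [DecidableEq m]
    {B C E F w y : Matrix m m ℂ} (hwy : w * y = 1) (hyw : y * w = 1) :
    (B - Complex.I • (C * y)) * w * (E + Complex.I • (y * F)) =
      B * w * E + C * y * F + Complex.I • (B * F - C * E) := by
  have h₁ : B * w * (y * F) = B * F := by rw [mul_assoc, ← mul_assoc w, hwy, one_mul]
  have h₂ : C * y * w * E = C * E := by rw [mul_assoc C, hyw, mul_one]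
  have h₃ : C * y * w * (y * F) = C * y * F := by rw [mul_assoc C, hyw, mul_one, mul_assoc]
  simp only [sub_mul, mul_add, smul_mul_assoc, mul_smul_comm, h₁, h₂, h₃, smul_sub, smul_smul,
    Complex.I_mul_I, neg_smul, one_smul]
  abel

/-- The Möbius numerator and denominator of a symmetric `v` form a symmetric pair. -/
theorem moebius_transpose_mul_comm {R m : Type*} [CommRing R] [Fintype m] [DecidableEq m]
    {a b c d v : Matrix m m R} (hv : vᵀ = v) (hac : aᵀ * c = cᵀ * a) (hbd : bᵀ * d = dᵀ * b)
    (had : aᵀ * d - cᵀ * b = 1) :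
    (a * v + b)ᵀ * (c * v + d) = (c * v + d)ᵀ * (a * v + b) := by
  have h₁ : aᵀ * d = 1 + cᵀ * b := sub_eq_iff_eq_add.mp had
  have h₂ : dᵀ * a = 1 + bᵀ * c := by simpa using congrArg transpose h₁
  calc (a * v + b)ᵀ * (c * v + d)
      = v * (aᵀ * c) * v + v * (aᵀ * d) + bᵀ * c * v + bᵀ * d := by
        simp only [transpose_add, transpose_mul, hv]; noncomm_ring
    _ = v * (cᵀ * a) * v + v * (cᵀ * b) + (dᵀ * a) * v + dᵀ * b := by
        rw [hac, h₁, hbd, h₂]; noncomm_ring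
    _ = (c * v + d)ᵀ * (a * v + b) := by
        simp only [transpose_add, transpose_mul, hv]; noncomm_ring

/-- Compatibility of the modified pre-Iwasawa decomposition with the Möbius action:
for `M = [[a,b],[c,d]] ∈ Sp(n,ℝ)` and `v' = x' + iy' ∈ 𝒳ₙ`, with
`A := c(y' + x'y'⁻¹x')cᵗ + dy'⁻¹dᵗ + cx'y'⁻¹dᵗ + dy'⁻¹x'cᵗ` and
`N := c(y' + x'y'⁻¹x')aᵗ + cx'y'⁻¹bᵗ + dy'⁻¹x'aᵗ + dy'⁻¹bᵗ`, the matrix `A` is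
invertible and `A⁻¹(N + i·I) = (av' + b)(cv' + d)⁻¹`. -/
theorem modified_preIwasawa_compatible (n : ℕ) (a b c d : Matrix (Fin n) (Fin n) ℝ)
    (hM : (fromBlocks a b c d)ᵀ * Jmat n * fromBlocks a b c d = Jmat n)
    (x' y' : Matrix (Fin n) (Fin n) ℝ)
    (hx_symm : x'ᵀ = x') (hy_symm : y'ᵀ = y') (hy_pd : y'.PosDef) :
    letI A := c * (y' + x' * y'⁻¹ * x') * cᵀ + d * y'⁻¹ * dᵀ +
      c * x' * y'⁻¹ * dᵀ + d * y'⁻¹ * x' * cᵀ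
    letI N := c * (y' + x' * y'⁻¹ * x') * aᵀ + c * x' * y'⁻¹ * bᵀ +
      d * y'⁻¹ * x' * aᵀ + d * y'⁻¹ * bᵀ
    letI aC := a.map Complex.ofReal
    letI bC := b.map Complex.ofReal
    letI cC := c.map Complex.ofReal
    letI dC := d.map Complex.ofReal
    letI v' := x'.map Complex.ofReal + Complex.I • y'.map Complex.ofReal
    IsUnit A ∧
    (A⁻¹).map Complex.ofReal *
        (N.map Complex.ofReal + Complex.I • (1 : Matrix (Fin n) (Fin n) ℂ)) =
      (aC * v' + bC) * (cC * v' + dC)⁻¹ := by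
  let A := c * (y' + x' * y'⁻¹ * x') * cᵀ + d * y'⁻¹ * dᵀ +
    c * x' * y'⁻¹ * dᵀ + d * y'⁻¹ * x' * cᵀ
  let N := c * (y' + x' * y'⁻¹ * x') * aᵀ + c * x' * y'⁻¹ * bᵀ +
    d * y'⁻¹ * x' * aᵀ + d * y'⁻¹ * bᵀ
  let aC := a.map Complex.ofReal
  let bC := b.map Complex.ofReal
  let cC := c.map Complex.ofReal
  let dC := d.map Complex.ofReal
  let v' := x'.map Complex.ofReal + Complex.I • y'.map Complex.ofReal
  change
    IsUnit A ∧
    (A⁻¹).map Complex.ofReal *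
        (N.map Complex.ofReal + Complex.I • (1 : Matrix (Fin n) (Fin n) ℂ)) =
      (aC * v' + bC) * (cC * v' + dC)⁻¹
  obtain ⟨⟨hac, hbd, had⟩, hcd, hda⟩ := symplectic_block_relations hM
  have hdet : IsUnit y'.det := (isUnit_iff_isUnit_det y').mp hy_pd.isUnit
  have hyw : y' * y'⁻¹ = 1 := mul_nonsing_inv _ hdet
  have hwy : y'⁻¹ * y' = 1 := nonsing_inv_mul _ hdet
  have hA : A = (c * x' + d) * y'⁻¹ * (c * x' + d)ᵀ + c * y' * cᵀ := by
    simp only [A, transpose_add, transpose_mul, hx_symm]; noncomm_ring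
  have hN : N = (c * x' + d) * y'⁻¹ * (a * x' + b)ᵀ + c * y' * aᵀ := by
    simp only [N, transpose_add, transpose_mul, hx_symm]; noncomm_ring
  have hAu : IsUnit A := by
    rw [hA]
    refine isUnit_add_of_posDef hy_pd.inv hy_pd fun u hB hC ↦ ?_
    have hD : dᵀ *ᵥ u = 0 := by
      simpa [add_mulVec, ← mulVec_mulVec, hC] using hB
    have h := congrArg (· *ᵥ u) (show a * dᵀ - b * cᵀ = 1 by
      simpa using congrArg transpose hda)
    simpa [sub_mulVec, ← mulVec_mulVec, hC, hD, eq_comm] using h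
  refine ⟨hAu, ?_⟩
  let φ : Matrix (Fin n) (Fin n) ℝ →+* Matrix (Fin n) (Fin n) ℂ := Complex.ofRealHom.mapMatrix
  have hφ (z : Matrix (Fin n) (Fin n) ℝ) : z.map Complex.ofReal = φ z := rfl
  have hφt (z : Matrix (Fin n) (Fin n) ℝ) : φ zᵀ = (φ z)ᵀ := rfl
  have hwyC : φ y'⁻¹ * φ y' = 1 := by rw [← map_mul, hwy, map_one]
  have hywC : φ y' * φ y'⁻¹ = 1 := by rw [← map_mul, hyw, map_one]
  have hv : v'ᵀ = v' := by
    simp only [v', hφ, transpose_add, transpose_smul, ← hφt, hx_symm, hy_symm]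
  have hden : (cC * v' + dC)ᵀ = φ (c * x' + d)ᵀ + Complex.I • (φ y' * φ cᵀ) := by
    simp only [cC, dC, v', hφ, mul_add, mul_smul_comm, transpose_add, transpose_smul,
      transpose_mul, ← hφt, hx_symm, hy_symm, map_add, map_mul]
    abel
  have hnum : (aC * v' + bC)ᵀ = φ (a * x' + b)ᵀ + Complex.I • (φ y' * φ aᵀ) := by
    simp only [aC, bC, v', hφ, mul_add, mul_smul_comm, transpose_add, transpose_smul,
      transpose_mul, ← hφt, hx_symm, hy_symm, map_add, map_mul]
    abel
  have hBc : (c * x' + d) * cᵀ - c * (c * x' + d)ᵀ = 0 := by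
    have : (c * x' + d) * cᵀ - c * (c * x' + d)ᵀ = d * cᵀ - c * dᵀ := by
      simp only [transpose_add, transpose_mul, hx_symm]; noncomm_ring
    rw [this, hcd, sub_self]
  have hBa : (c * x' + d) * aᵀ - c * (a * x' + b)ᵀ = 1 := by
    rw [← hda]
    simp only [transpose_add, transpose_mul, hx_symm]; noncomm_ring
  set W : Matrix (Fin n) (Fin n) ℂ :=
    (φ (c * x' + d) - Complex.I • (φ c * φ y')) * φ y'⁻¹ with hW
  have hAC : φ A = W * (cC * v' + dC)ᵀ := by
    rw [hden, hW, sub_I_smul_mul_mul_add_I_smul hwyC hywC]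
    simp only [← map_mul, ← map_add, ← map_sub, hBc, ← hA]
    simp
  have hNC : φ N + Complex.I • 1 = W * (aC * v' + bC)ᵀ := by
    rw [hnum, hW, sub_I_smul_mul_mul_add_I_smul hwyC hywC]
    simp only [← map_mul, ← map_add, ← map_sub, hBa, ← hN]
    simp
  have hsymm : (aC * v' + bC)ᵀ * (cC * v' + dC) = (cC * v' + dC)ᵀ * (aC * v' + bC) := by
    refine moebius_transpose_mul_comm hv ?_ ?_ ?_ <;>
      simp only [aC, bC, cC, dC, hφ, ← hφt, ← map_mul, ← map_sub, hac, hbd, had, map_one]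
  have hAinv : φ A⁻¹ * φ A = 1 := by
    rw [← map_mul, nonsing_inv_mul _ ((isUnit_iff_isUnit_det A).mp hAu), map_one]
  have hdenu : IsUnit (cC * v' + dC).det := by
    have h : (φ A⁻¹ * W) * (cC * v' + dC)ᵀ = 1 := by rw [mul_assoc, ← hAC, hAinv]
    rw [← det_transpose]
    exact isUnit_det_of_left_inverse h
  rw [hφ, hφ, hNC]
  calc φ A⁻¹ * (W * (aC * v' + bC)ᵀ)
      = φ A⁻¹ * (W * (aC * v' + bC)ᵀ) * (cC * v' + dC) * (cC * v' + dC)⁻¹ := by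
        rw [mul_nonsing_inv_cancel_right _ _ hdenu]
    _ = φ A⁻¹ * (W * ((aC * v' + bC)ᵀ * (cC * v' + dC))) * (cC * v' + dC)⁻¹ := by
        simp only [mul_assoc]
    _ = φ A⁻¹ * φ A * (aC * v' + bC) * (cC * v' + dC)⁻¹ := by
        rw [hsymm, hAC]; simp only [mul_assoc]
    _ = (aC * v' + bC) * (cC * v' + dC)⁻¹ := by rw [hAinv, one_mul]
end

section
/- Invariance of the two-parameter metric on the Siegel–Jacobi upper half space 𝒳^J_n: let α, γ > 0, fix (M,(λ,μ)) with M = [[a,b],[c,d]] ∈ Sp(n,ℝ), λ, μ ∈ M(1,n,ℝ), and set p := λdᵗ − μcᵗ, q := −λbᵗ + μaᵗ. Let x', y' : ℝ → M(n,ℝ) be differentiable with x'(t) symmetric, y'(t) symmetric positive definite for all t, and p', q' : ℝ → M(1,n,ℝ) differentiable. Define v'(t) := x'(t) + i y'(t), v₁(t) := (a v'(t) + b)(c v'(t) + d)^{-1}, x₁(t) := (v₁(t) + v̄₁(t))/2, y₁(t) := (v₁(t) − v̄₁(t))/(2i), p₁(t) := p + p'(t)dᵗ − q'(t)cᵗ,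 q₁(t) := q − p'(t)bᵗ + q'(t)aᵗ. Then for every t, α·tr[(y₁^{-1}·dx₁/dt)² + (y₁^{-1}·dy₁/dt)²] + γ·[(dp₁/dt)(x₁y₁^{-1}x₁ + y₁)(dp₁/dt)ᵗ + (dq₁/dt)y₁^{-1}(dq₁/dt)ᵗ + 2(dp₁/dt)x₁y₁^{-1}(dq₁/dt)ᵗ] = α·tr[(y'^{-1}·dx'/dt)² + (y'^{-1}·dy'/dt)²] + γ·[(dp'/dt)(x'y'^{-1}x' + y')(dp'/dt)ᵗ + (dq'/dt)y'^{-1}(dq'/dt)ᵗ + 2(dp'/dt)x'y'^{-1}(dq'/dt)ᵗ]. -/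
open Matrix

/-- Entrywise derivative of a matrix-valued function of a real variable. -/
noncomputable def mderiv {m k : Type*} (f : ℝ → Matrix m k ℝ) (t : ℝ) : Matrix m k ℝ :=
  Matrix.of fun i j => deriv (fun s => f s i j) t

/-- The value of the two-parameter metric of the Siegel–Jacobi upper half space
`α·tr[(y⁻¹dx)² + (y⁻¹dy)²] + γ·[dp(xy⁻¹x + y)dpᵗ + dq y⁻¹ dqᵗ + 2 dp xy⁻¹ dqᵗ]`
on the tangent vector `(dx, dy, dp, dq)` at the point `(x, y, p, q)`. -/
noncomputable def sjMetric (n : ℕ) (α γ : ℝ) (x y dx dy : Matrix (Fin n) (Fin n) ℝ)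
    (dp dq : Matrix (Fin 1) (Fin n) ℝ) : ℝ :=
  α * Matrix.trace (y⁻¹ * dx * (y⁻¹ * dx) + y⁻¹ * dy * (y⁻¹ * dy)) +
  γ * ((dp * (x * y⁻¹ * x + y) * dpᵀ) 0 0 + (dq * y⁻¹ * dqᵀ) 0 0 +
    2 * (dp * (x * y⁻¹) * dqᵀ) 0 0)

/-- Entrywise differentiability of a matrix-valued function, with prescribed derivative. -/
def HasMDerivAt {m k 𝕜 : Type*} [NontriviallyNormedField 𝕜] [NormedAlgebra ℝ 𝕜]
    (f : ℝ → Matrix m k 𝕜) (f' : Matrix m k 𝕜) (t : ℝ) : Prop :=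
  ∀ i j, HasDerivAt (fun s => f s i j) (f' i j) t

section Calculus

variable {l m k 𝕜 : Type*} [NontriviallyNormedField 𝕜] [NormedAlgebra ℝ 𝕜]

theorem HasMDerivAt.mderiv_eq {f : ℝ → Matrix m k ℝ} {f' : Matrix m k ℝ} {t : ℝ}
    (hf : HasMDerivAt f f' t) : mderiv f t = f' := by
  ext i j
  exact (hf i j).deriv

theorem hasMDerivAt_mderiv {f : ℝ → Matrix m k ℝ}
    (hf : ∀ i j, Differentiable ℝ fun t => f t i j) (t : ℝ) : HasMDerivAt f (mderiv f t) t :=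
  fun i j => (hf i j t).hasDerivAt

theorem hasMDerivAt_const (a : Matrix m k 𝕜) (t : ℝ) : HasMDerivAt (fun _ => a) 0 t :=
  fun i j => hasDerivAt_const t (a i j)

theorem HasMDerivAt.add {f g : ℝ → Matrix m k 𝕜} {f' g' : Matrix m k 𝕜} {t : ℝ}
    (hf : HasMDerivAt f f' t) (hg : HasMDerivAt g g' t) :
    HasMDerivAt (fun s => f s + g s) (f' + g') t :=
  fun i j => (hf i j).fun_add (hg i j)

theorem HasMDerivAt.sub {f g : ℝ → Matrix m k 𝕜} {f' g' : Matrix m k 𝕜} {t : ℝ}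
    (hf : HasMDerivAt f f' t) (hg : HasMDerivAt g g' t) :
    HasMDerivAt (fun s => f s - g s) (f' - g') t :=
  fun i j => (hf i j).fun_sub (hg i j)

theorem HasMDerivAt.transpose {f : ℝ → Matrix m k 𝕜} {f' : Matrix m k 𝕜} {t : ℝ}
    (hf : HasMDerivAt f f' t) : HasMDerivAt (fun s => (f s)ᵀ) f'ᵀ t :=
  fun i j => hf j i

theorem HasMDerivAt.mul [Fintype m] {f : ℝ → Matrix l m 𝕜} {g : ℝ → Matrix m k 𝕜}
    {f' : Matrix l m 𝕜} {g' : Matrix m k 𝕜} {t : ℝ}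
    (hf : HasMDerivAt f f' t) (hg : HasMDerivAt g g' t) :
    HasMDerivAt (fun s => f s * g s) (f' * g t + f t * g') t := by
  intro i j
  simp only [Matrix.mul_apply, Matrix.add_apply, ← Finset.sum_add_distrib]
  exact HasDerivAt.fun_sum fun r _ => (hf i r).fun_mul (hg r j)

theorem HasMDerivAt.map_ofReal {f : ℝ → Matrix m k ℝ} {f' : Matrix m k ℝ} {t : ℝ}
    (hf : HasMDerivAt f f' t) :
    HasMDerivAt (fun s => (f s).map Complex.ofReal) (f'.map Complex.ofReal) t :=
  fun i j => (hf i j).ofReal_comp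

theorem HasMDerivAt.const_smul (z : 𝕜) {f : ℝ → Matrix m k 𝕜} {f' : Matrix m k 𝕜} {t : ℝ}
    (hf : HasMDerivAt f f' t) : HasMDerivAt (fun s => z • f s) (z • f') t :=
  fun i j => (hf i j).const_mul z

theorem HasMDerivAt.map_re {f : ℝ → Matrix m k ℂ} {f' : Matrix m k ℂ} {t : ℝ}
    (hf : HasMDerivAt f f' t) :
    HasMDerivAt (fun s => (f s).map Complex.re) (f'.map Complex.re) t :=
  fun i j => Complex.reCLM.hasFDerivAt.comp_hasDerivAt t (hf i j)

theorem HasMDerivAt.map_im {f : ℝ → Matrix m k ℂ} {f' : Matrix m k ℂ} {t : ℝ}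
    (hf : HasMDerivAt f f' t) :
    HasMDerivAt (fun s => (f s).map Complex.im) (f'.map Complex.im) t :=
  fun i j => Complex.imCLM.hasFDerivAt.comp_hasDerivAt t (hf i j)

theorem differentiableAt_det [Fintype m] [DecidableEq m] {f : ℝ → Matrix m m 𝕜} {t : ℝ}
    (hf : ∀ i j, DifferentiableAt ℝ (fun s => f s i j) t) :
    DifferentiableAt ℝ (fun s => (f s).det) t := by
  simp only [Matrix.det_apply']
  exact DifferentiableAt.fun_sum fun σ _ =>
    (DifferentiableAt.fun_finsetProd fun i _ => hf (σ i) i).const_mul _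

theorem differentiableAt_inv_apply [Fintype m] [DecidableEq m] {f : ℝ → Matrix m m 𝕜} {t : ℝ}
    (hf : ∀ i j, DifferentiableAt ℝ (fun s => f s i j) t) (h : IsUnit (f t).det) (i j : m) :
    DifferentiableAt ℝ (fun s => (f s)⁻¹ i j) t := by
  simp only [Matrix.inv_def, Matrix.smul_apply, smul_eq_mul, Ring.inverse_eq_inv',
    Matrix.adjugate_apply]
  refine ((differentiableAt_det hf).fun_inv h.ne_zero).fun_mul (differentiableAt_det ?_)
  intro r s
  by_cases hr : r = j
  · subst hr
    simp
  · simpa [Matrix.updateRow_apply, hr] using hf r s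

theorem HasMDerivAt.exists_inv [Fintype m] [DecidableEq m] {f : ℝ → Matrix m m 𝕜}
    {f' : Matrix m m 𝕜} {t : ℝ} (hf : HasMDerivAt f f' t) (h : IsUnit (f t).det) :
    ∃ g', HasMDerivAt (fun s => (f s)⁻¹) g' t :=
  ⟨Matrix.of fun i j => deriv (fun s => (f s)⁻¹ i j) t, fun i j =>
    (differentiableAt_inv_apply (fun i j => (hf i j).differentiableAt) h i j).hasDerivAt⟩

end Calculus

section Algebra

variable {m k R : Type*} [Fintype m] [DecidableEq m] [CommRing R]

theorem symplectic_pairing {A B C D U W : Matrix m m R}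
    (hac : Aᵀ * C = Cᵀ * A) (hbd : Bᵀ * D = Dᵀ * B) (had : Aᵀ * D - Cᵀ * B = 1)
    (hda : Dᵀ * A - Bᵀ * C = 1) (hU : Uᵀ = U) :
    (A * U + B)ᵀ * (C * W + D) - (C * U + D)ᵀ * (A * W + B) = U - W := by
  have h : (A * U + B)ᵀ * (C * W + D) - (C * U + D)ᵀ * (A * W + B) =
      U * (Aᵀ * C - Cᵀ * A) * W + U * (Aᵀ * D - Cᵀ * B) - (Dᵀ * A - Bᵀ * C) * W
        + (Bᵀ * D - Dᵀ * B) := by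
    simp only [transpose_add, transpose_mul, hU]
    noncomm_ring
  rw [h, hac, hbd, had, hda]
  simp

theorem moebius_transpose {A B C D U : Matrix m m R}
    (hac : Aᵀ * C = Cᵀ * A) (hbd : Bᵀ * D = Dᵀ * B) (had : Aᵀ * D - Cᵀ * B = 1)
    (hda : Dᵀ * A - Bᵀ * C = 1) (hU : Uᵀ = U) (h : IsUnit (C * U + D).det) :
    ((A * U + B) * (C * U + D)⁻¹)ᵀ = (A * U + B) * (C * U + D)⁻¹ := by
  have hp := symplectic_pairing hac hbd had hda hU (W := U)
  rw [sub_self, sub_eq_zero] at hp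
  have hT : IsUnit (C * U + D)ᵀ.det := by rwa [det_transpose]
  rw [transpose_mul, transpose_nonsing_inv]
  calc ((C * U + D)ᵀ)⁻¹ * (A * U + B)ᵀ
      = ((C * U + D)ᵀ)⁻¹ * ((A * U + B)ᵀ * (C * U + D)) * (C * U + D)⁻¹ := by
        rw [← Matrix.mul_assoc, mul_nonsing_inv_cancel_right _ _ h]
    _ = _ := by rw [hp, nonsing_inv_mul_cancel_left _ _ hT]

theorem moebius_sub {A B C D U W : Matrix m m R}
    (hac : Aᵀ * C = Cᵀ * A) (hbd : Bᵀ * D = Dᵀ * B) (had : Aᵀ * D - Cᵀ * B = 1)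
    (hda : Dᵀ * A - Bᵀ * C = 1) (hU : Uᵀ = U)
    (hNU : IsUnit (C * U + D).det) (hNW : IsUnit (C * W + D).det) :
    (C * U + D)ᵀ * ((A * U + B) * (C * U + D)⁻¹ - (A * W + B) * (C * W + D)⁻¹) * (C * W + D)
      = U - W := by
  have hT : IsUnit (C * U + D)ᵀ.det := by rwa [det_transpose]
  rw [← symplectic_pairing hac hbd had hda hU, ← moebius_transpose hac hbd had hda hU hNU,
    Matrix.mul_sub, Matrix.sub_mul, transpose_mul, transpose_nonsing_inv,
    mul_nonsing_inv_cancel_left _ _ hT, Matrix.mul_assoc, Matrix.mul_assoc,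
    nonsing_inv_mul _ hNW, Matrix.mul_one]

theorem row_moebius {A B C D W : Matrix m m R} {p q : Matrix k m R}
    (hac : Aᵀ * C = Cᵀ * A) (hbd : Bᵀ * D = Dᵀ * B) (had : Aᵀ * D - Cᵀ * B = 1)
    (hda : Dᵀ * A - Bᵀ * C = 1) (hNW : IsUnit (C * W + D).det) :
    (p * Dᵀ - q * Cᵀ) * ((A * W + B) * (C * W + D)⁻¹) + (q * Aᵀ - p * Bᵀ)
      = (p * W + q) * (C * W + D)⁻¹ := by
  have h : (p * Dᵀ - q * Cᵀ) * (A * W + B) + (q * Aᵀ - p * Bᵀ) * (C * W + D) = p * W + q := by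
    have h' : (p * Dᵀ - q * Cᵀ) * (A * W + B) + (q * Aᵀ - p * Bᵀ) * (C * W + D) =
        p * ((Dᵀ * A - Bᵀ * C) * W) - p * (Bᵀ * D - Dᵀ * B) + q * (Aᵀ * D - Cᵀ * B)
          + q * ((Aᵀ * C - Cᵀ * A) * W) := by
      simp only [Matrix.mul_add, Matrix.mul_sub, Matrix.sub_mul, Matrix.mul_assoc]
      abel
    rw [h', hac, hbd, had, hda]
    simp
  rw [← h, Matrix.add_mul (_ * (A * W + B)), Matrix.mul_assoc _ (A * W + B),
    mul_nonsing_inv_cancel_right _ _ hNW]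

end Algebra

section Complexification

theorem map_ofReal_mul {l m k : Type*} [Fintype m] (a : Matrix l m ℝ) (b : Matrix m k ℝ) :
    (a * b).map Complex.ofReal = a.map Complex.ofReal * b.map Complex.ofReal :=
  Matrix.map_mul (f := Complex.ofRealHom)

variable {m : Type*} [Fintype m] [DecidableEq m]

theorem map_ofReal_inv {a : Matrix m m ℝ} (h : IsUnit a.det) :
    (a⁻¹).map Complex.ofReal = (a.map Complex.ofReal)⁻¹ := by
  refine (inv_eq_left_inv ?_).symm
  rw [← map_ofReal_mul, nonsing_inv_mul _ h]
  simp

theorem star_dotProduct_map_ofReal_mulVec_re {m : Type*} [Fintype m] (y : Matrix m m ℝ) (w : m → ℂ) :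
    (star w ⬝ᵥ (y.map Complex.ofReal *ᵥ w)).re =
      (fun i => (w i).re) ⬝ᵥ (y *ᵥ fun i => (w i).re) +
      (fun i => (w i).im) ⬝ᵥ (y *ᵥ fun i => (w i).im) := by
  simp [dotProduct, mulVec, Complex.re_sum, Complex.im_sum, Finset.sum_add_distrib]

theorem Matrix.PosDef.eq_zero_of_map_ofReal {m : Type*} [Fintype m] {y : Matrix m m ℝ} (hy : y.PosDef) {w : m → ℂ}
    (hw : star w ⬝ᵥ (y.map Complex.ofReal *ᵥ w) = 0) : w = 0 := by
  have h := star_dotProduct_map_ofReal_mulVec_re y w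
  rw [hw, Complex.zero_re] at h
  have hre := hy.posSemidef.dotProduct_mulVec_nonneg fun i => (w i).re
  have him := hy.posSemidef.dotProduct_mulVec_nonneg fun i => (w i).im
  simp only [star_trivial] at hre him
  have hre0 : (fun i => (w i).re) = 0 := by
    by_contra hne
    have := hy.dotProduct_mulVec_pos hne
    simp only [star_trivial] at this
    linarith
  have him0 : (fun i => (w i).im) = 0 := by
    by_contra hne
    have := hy.dotProduct_mulVec_pos hne
    simp only [star_trivial] at this
    linarith
  ext i
  exact Complex.ext (congrFun hre0 i) (congrFun him0 i)

theorem isUnit_det_automorphy {N Nb P Pb V Vb : Matrix m m ℂ} {y : Matrix m m ℝ}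
    (hpd : y.PosDef) (hNb : Nb = N.map (starRingEnd ℂ))
    (hV : V - Vb = (2 * Complex.I) • y.map Complex.ofReal)
    (hpair : Pbᵀ * N - Nbᵀ * P = Vb - V) : IsUnit N.det := by
  rw [isUnit_iff_ne_zero]
  intro h0
  obtain ⟨w, hw, hNw⟩ := exists_mulVec_eq_zero_iff.mpr h0
  refine hw (hpd.eq_zero_of_map_ofReal ?_)
  have hstar : star w ᵥ* Nbᵀ = 0 := by
    rw [vecMul_transpose, hNb]
    ext i
    have := congrArg (starRingEnd ℂ) (congrFun hNw i)
    simpa [mulVec, dotProduct] using this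
  have h : star w ⬝ᵥ ((V - Vb) *ᵥ w) = 0 := by
    rw [← neg_sub, ← hpair, neg_sub, sub_mulVec, ← mulVec_mulVec, ← mulVec_mulVec, hNw,
      mulVec_zero, sub_zero, dotProduct_mulVec, hstar, zero_dotProduct]
  rw [hV, smul_mulVec, dotProduct_smul, smul_eq_mul] at h
  simpa using h

theorem sjMetric_complex {n : ℕ} {α γ : ℝ} {x y dx dy : Matrix (Fin n) (Fin n) ℝ}
    {dp dq : Matrix (Fin 1) (Fin n) ℝ} {V Vb dV dVb : Matrix (Fin n) (Fin n) ℂ}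
    (hx : xᵀ = x) (hy : yᵀ = y) (hu : IsUnit y.det)
    (hV : V = x.map Complex.ofReal + Complex.I • y.map Complex.ofReal)
    (hVb : Vb = x.map Complex.ofReal - Complex.I • y.map Complex.ofReal)
    (hdV : dV = dx.map Complex.ofReal + Complex.I • dy.map Complex.ofReal)
    (hdVb : dVb = dx.map Complex.ofReal - Complex.I • dy.map Complex.ofReal) :
    (sjMetric n α γ x y dx dy dp dq : ℂ) =
      α * Matrix.trace ((y.map Complex.ofReal)⁻¹ * dV * ((y.map Complex.ofReal)⁻¹ * dVb)) +
      γ * ((dp.map Complex.ofReal * V + dq.map Complex.ofReal) * (y.map Complex.ofReal)⁻¹ *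
        (dp.map Complex.ofReal * Vb + dq.map Complex.ofReal)ᵀ) 0 0 := by
  have htr : ∀ M : Matrix (Fin n) (Fin n) ℝ,
      ((trace M : ℝ) : ℂ) = trace (M.map Complex.ofReal) := fun M => by simp [trace]
  have hent : ∀ M : Matrix (Fin 1) (Fin 1) ℝ,
      ((M 0 0 : ℝ) : ℂ) = M.map Complex.ofReal 0 0 := fun M => rfl
  have hadd : ∀ {k l : Type} (M M' : Matrix k l ℝ), (M + M').map Complex.ofReal =
      M.map Complex.ofReal + M'.map Complex.ofReal := fun M M' => by ext; simp
  have hYu : IsUnit (y.map Complex.ofReal).det := by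
    have : (y.map Complex.ofReal).det = Complex.ofRealHom y.det :=
      (RingHom.map_det Complex.ofRealHom y).symm
    rw [this]
    exact hu.map _
  have hXt : (x.map Complex.ofReal)ᵀ = x.map Complex.ofReal := by rw [← transpose_map, hx]
  have hYt : (y.map Complex.ofReal)ᵀ = y.map Complex.ofReal := by rw [← transpose_map, hy]
  have h1 := mul_nonsing_inv _ hYu
  have h2 := nonsing_inv_mul _ hYu
  have hYit : ((y.map Complex.ofReal)⁻¹)ᵀ = (y.map Complex.ofReal)⁻¹ := by
    rw [transpose_nonsing_inv, hYt]
  unfold sjMetric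
  push_cast
  rw [htr, hent, hent, hent]
  simp only [hadd, map_ofReal_mul, map_ofReal_inv hu, transpose_map]
  subst hV hVb hdV hdVb
  generalize x.map Complex.ofReal = X at *
  generalize (y.map Complex.ofReal)⁻¹ = Yi at *
  generalize y.map Complex.ofReal = Y at *
  generalize dx.map Complex.ofReal = dX at *
  generalize dy.map Complex.ofReal = dY at *
  generalize dp.map Complex.ofReal = P at *
  generalize dq.map Complex.ofReal = Q at *
  have hT : trace (Yi * (dX + Complex.I • dY) * (Yi * (dX - Complex.I • dY))) =
      trace (Yi * dX * (Yi * dX) + Yi * dY * (Yi * dY)) := by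
    simp only [Matrix.mul_add, Matrix.mul_sub, Matrix.add_mul, Matrix.mul_smul, Matrix.smul_mul,
      trace_add, trace_sub, trace_smul, smul_eq_mul]
    rw [trace_mul_comm (Yi * dX) (Yi * dY)]
    linear_combination (-trace (Yi * dY * (Yi * dY))) * Complex.I_mul_I
  have hR : (P * (X + Complex.I • Y) + Q) * Yi * (P * (X - Complex.I • Y) + Q)ᵀ =
      P * (X * Yi * X + Y) * Pᵀ + Q * Yi * Qᵀ + P * (X * Yi) * Qᵀ + (P * (X * Yi) * Qᵀ)ᵀ
        + Complex.I • (P * Qᵀ - (P * Qᵀ)ᵀ) := by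
    have e1 : ∀ {k : Type} (M : Matrix (Fin n) k ℂ), Y * (Yi * M) = M := fun M => by
      rw [← Matrix.mul_assoc, h1, Matrix.one_mul]
    have e2 : ∀ {k : Type} (M : Matrix (Fin n) k ℂ), Yi * (Y * M) = M := fun M => by
      rw [← Matrix.mul_assoc, h2, Matrix.one_mul]
    simp only [transpose_add, transpose_sub, transpose_mul, transpose_smul, transpose_transpose,
      hXt, hYt, hYit, Matrix.mul_add, Matrix.mul_sub, Matrix.add_mul,
      Matrix.mul_smul, Matrix.smul_mul, Matrix.mul_assoc, smul_add, smul_sub, smul_smul, e1, e2,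
      Complex.I_mul_I, neg_smul, one_smul]
    abel
  rw [hT, hR]
  simp only [Matrix.add_apply, Matrix.smul_apply, Matrix.sub_apply, transpose_apply, smul_eq_mul]
  ring

theorem map_conj_mul {l m k : Type*} [Fintype m] (a : Matrix l m ℂ) (b : Matrix m k ℂ) :
    (a * b).map (starRingEnd ℂ) = a.map (starRingEnd ℂ) * b.map (starRingEnd ℂ) :=
  Matrix.map_mul

theorem map_conj_inv {a : Matrix m m ℂ} (h : IsUnit a.det) :
    (a⁻¹).map (starRingEnd ℂ) = (a.map (starRingEnd ℂ))⁻¹ := by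
  refine (inv_eq_left_inv ?_).symm
  rw [← map_conj_mul, nonsing_inv_mul _ h]
  simp

theorem map_conj_ofReal {l k : Type*} (a : Matrix l k ℝ) :
    (a.map Complex.ofReal).map (starRingEnd ℂ) = a.map Complex.ofReal := by
  ext
  simp

theorem map_conj_add_I_smul {l k : Type*} (a b : Matrix l k ℝ) :
    (a.map Complex.ofReal + Complex.I • b.map Complex.ofReal).map (starRingEnd ℂ) =
      a.map Complex.ofReal - Complex.I • b.map Complex.ofReal := by
  ext
  simp [sub_eq_add_neg]

theorem map_re_add_I_smul_map_im {l k : Type*} (Z : Matrix l k ℂ) :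
    Z = (Z.map Complex.re).map Complex.ofReal
      + Complex.I • (Z.map Complex.im).map Complex.ofReal := by
  ext i j
  simp [mul_comm Complex.I, Complex.re_add_im]

theorem map_conj_eq_re_sub_im {l k : Type*} (Z : Matrix l k ℂ) :
    Z.map (starRingEnd ℂ) = (Z.map Complex.re).map Complex.ofReal
      - Complex.I • (Z.map Complex.im).map Complex.ofReal := by
  rw [← map_conj_add_I_smul, ← map_re_add_I_smul_map_im]

/-- The substitution `y ↦ N y⁻¹ Nbᵀ`, `dv ↦ N⁻ᵀ dv N⁻¹`, `w ↦ w N⁻¹` leaves the complex form of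
the metric unchanged. -/
theorem complex_metric_congr {k R : Type*} [CommRing R] {N Nb Y Y₁ dV dVb : Matrix m m R}
    {w wb : Matrix k m R}
    (h1 : Nᵀ * Y₁ * Nb = Y) (h2 : Nbᵀ * Y₁ * N = Y) :
    Matrix.trace (Y₁⁻¹ * ((N⁻¹)ᵀ * dV * N⁻¹) * (Y₁⁻¹ * ((Nb⁻¹)ᵀ * dVb * Nb⁻¹))) =
        Matrix.trace (Y⁻¹ * dV * (Y⁻¹ * dVb)) ∧
      (w * N⁻¹) * Y₁⁻¹ * (wb * Nb⁻¹)ᵀ = w * Y⁻¹ * wbᵀ := by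
  subst h1
  have h3 : (Nᵀ * Y₁ * Nb)⁻¹ = N⁻¹ * Y₁⁻¹ * (Nb⁻¹)ᵀ := by
    rw [← h2, Matrix.mul_inv_rev, Matrix.mul_inv_rev, transpose_nonsing_inv, Matrix.mul_assoc]
  have h4 : (Nᵀ * Y₁ * Nb)⁻¹ = Nb⁻¹ * Y₁⁻¹ * (N⁻¹)ᵀ := by
    rw [Matrix.mul_inv_rev, Matrix.mul_inv_rev, transpose_nonsing_inv, Matrix.mul_assoc]
  constructor
  · calc _ = Matrix.trace ((Y₁⁻¹ * (N⁻¹)ᵀ * dV * (N⁻¹ * Y₁⁻¹ * (Nb⁻¹)ᵀ) * dVb) * Nb⁻¹) := by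
          simp only [Matrix.mul_assoc]
      _ = Matrix.trace (Nb⁻¹ * Y₁⁻¹ * (N⁻¹)ᵀ * dV * (N⁻¹ * Y₁⁻¹ * (Nb⁻¹)ᵀ * dVb)) := by
          rw [trace_mul_comm]
          simp only [Matrix.mul_assoc]
      _ = _ := by rw [← h3, ← h4]
  · rw [h3, transpose_mul]
    simp only [Matrix.mul_assoc]

end Complexification

section Derivative

variable {m 𝕜 : Type*} [Fintype m] [DecidableEq m] [NontriviallyNormedField 𝕜]
  [NormedAlgebra ℝ 𝕜]

theorem HasMDerivAt.moebius {A B C D : Matrix m m 𝕜} {V : ℝ → Matrix m m 𝕜} {dV : Matrix m m 𝕜}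
    {t : ℝ} (hac : Aᵀ * C = Cᵀ * A) (hbd : Bᵀ * D = Dᵀ * B) (had : Aᵀ * D - Cᵀ * B = 1)
    (hda : Dᵀ * A - Bᵀ * C = 1) (hVt : ∀ s, (V s)ᵀ = V s)
    (hN : ∀ s, IsUnit (C * V s + D).det) (hV : HasMDerivAt V dV t) :
    HasMDerivAt (fun s => (A * V s + B) * (C * V s + D)⁻¹)
      (((C * V t + D)⁻¹)ᵀ * dV * (C * V t + D)⁻¹) t := by
  obtain ⟨G, hG⟩ := (((hasMDerivAt_const C t).mul hV).add (hasMDerivAt_const D t)).exists_inv (hN t)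
  have h := (hasMDerivAt_const ((A * V t + B) * (C * V t + D)⁻¹) t).add
    ((hG.transpose.mul (hV.sub (hasMDerivAt_const (V t) t))).mul
      (hasMDerivAt_const ((C * V t + D)⁻¹) t))
  have hfun : (fun s => (A * V s + B) * (C * V s + D)⁻¹) = fun s =>
      (A * V t + B) * (C * V t + D)⁻¹
        + ((C * V s + D)⁻¹)ᵀ * (V s - V t) * (C * V t + D)⁻¹ := by
    funext s
    have hT : IsUnit (C * V s + D)ᵀ.det := by rw [det_transpose]; exact hN s
    rw [← moebius_sub hac hbd had hda (hVt s) (hN s) (hN t), transpose_nonsing_inv,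
      Matrix.mul_assoc _ _ (C * V t + D), nonsing_inv_mul_cancel_left _ _ hT,
      mul_nonsing_inv_cancel_right _ _ (hN t)]
    abel
  rw [hfun]
  simpa using h

end Derivative

theorem symplectic_relations {n : ℕ} {a b c d : Matrix (Fin n) (Fin n) ℝ}
    (hM : (fromBlocks a b c d)ᵀ * Jmat n * fromBlocks a b c d = Jmat n) :
    aᵀ * c = cᵀ * a ∧ bᵀ * d = dᵀ * b ∧ aᵀ * d - cᵀ * b = 1 ∧ dᵀ * a - bᵀ * c = 1 := by
  simp only [Jmat, fromBlocks_transpose, fromBlocks_multiply, fromBlocks_inj, Matrix.mul_zero,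
    Matrix.mul_one, Matrix.mul_neg, Matrix.neg_mul, zero_add, add_zero] at hM
  obtain ⟨h1, h2, h3, h4⟩ := hM
  refine ⟨?_, ?_, ?_, ?_⟩
  · rw [← sub_eq_zero, ← h1]
    abel
  · rw [← sub_eq_zero, ← h4]
    abel
  · rw [← sub_eq_zero, ← h2]
    abel
  · rw [← neg_inj, ← h3]
    abel



/-- Invariance of the two-parameter metric on the Siegel–Jacobi upper half space
`𝒳^J_n` under the action of the restricted real Jacobi group. -/
theorem sjMetric_invariant (n : ℕ) (α γ : ℝ) (hα : 0 < α) (hγ : 0 < γ)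
    (a b c d : Matrix (Fin n) (Fin n) ℝ)
    (hM : (fromBlocks a b c d)ᵀ * Jmat n * fromBlocks a b c d = Jmat n)
    (lam mu : Matrix (Fin 1) (Fin n) ℝ)
    (x' y' : ℝ → Matrix (Fin n) (Fin n) ℝ)
    (hx'symm : ∀ t, (x' t)ᵀ = x' t) (hy'symm : ∀ t, (y' t)ᵀ = y' t)
    (hy'pd : ∀ t, (y' t).PosDef)
    (hx' : ∀ i j, Differentiable ℝ fun t => x' t i j)
    (hy' : ∀ i j, Differentiable ℝ fun t => y' t i j)
    (p' q' : ℝ → Matrix (Fin 1) (Fin n) ℝ)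
    (hp' : ∀ i j, Differentiable ℝ fun t => p' t i j)
    (hq' : ∀ i j, Differentiable ℝ fun t => q' t i j) (t : ℝ) :
    letI p := lam * dᵀ - mu * cᵀ
    letI q := -(lam * bᵀ) + mu * aᵀ
    letI v' : ℝ → Matrix (Fin n) (Fin n) ℂ := fun s =>
      (x' s).map Complex.ofReal + Complex.I • (y' s).map Complex.ofReal
    letI v₁ : ℝ → Matrix (Fin n) (Fin n) ℂ := fun s =>
      (a.map Complex.ofReal * v' s + b.map Complex.ofReal) *
        (c.map Complex.ofReal * v' s + d.map Complex.ofReal)⁻¹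
    letI x₁ : ℝ → Matrix (Fin n) (Fin n) ℝ := fun s => (v₁ s).map Complex.re
    letI y₁ : ℝ → Matrix (Fin n) (Fin n) ℝ := fun s => (v₁ s).map Complex.im
    letI p₁ : ℝ → Matrix (Fin 1) (Fin n) ℝ := fun s => p + p' s * dᵀ - q' s * cᵀ
    letI q₁ : ℝ → Matrix (Fin 1) (Fin n) ℝ := fun s => q - p' s * bᵀ + q' s * aᵀ
    sjMetric n α γ (x₁ t) (y₁ t) (mderiv x₁ t) (mderiv y₁ t)
        (mderiv p₁ t) (mderiv q₁ t) =
      sjMetric n α γ (x' t) (y' t) (mderiv x' t) (mderiv y' t)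
        (mderiv p' t) (mderiv q' t) := by
  obtain ⟨rac, rbd, rad, rda⟩ := symplectic_relations hM
  have hsub : ∀ M M' : Matrix (Fin n) (Fin n) ℝ, (M - M').map Complex.ofReal =
      M.map Complex.ofReal - M'.map Complex.ofReal := fun M M' => by ext; simp
  have hone : (1 : Matrix (Fin n) (Fin n) ℝ).map Complex.ofReal = 1 := by simp
  have hp₁ : mderiv (fun s => lam * dᵀ - mu * cᵀ + p' s * dᵀ - q' s * cᵀ) t =
      mderiv p' t * dᵀ - mderiv q' t * cᵀ := by
    have h := (((hasMDerivAt_const (lam * dᵀ - mu * cᵀ) t).add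
      ((hasMDerivAt_mderiv hp' t).mul (hasMDerivAt_const dᵀ t))).sub
      ((hasMDerivAt_mderiv hq' t).mul (hasMDerivAt_const cᵀ t))).mderiv_eq
    simpa using h
  have hq₁ : mderiv (fun s => -(lam * bᵀ) + mu * aᵀ - p' s * bᵀ + q' s * aᵀ) t =
      mderiv q' t * aᵀ - mderiv p' t * bᵀ := by
    have h := (((hasMDerivAt_const (-(lam * bᵀ) + mu * aᵀ) t).sub
      ((hasMDerivAt_mderiv hp' t).mul (hasMDerivAt_const bᵀ t))).add
      ((hasMDerivAt_mderiv hq' t).mul (hasMDerivAt_const aᵀ t))).mderiv_eq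
    rw [h]
    simp only [Matrix.mul_zero, add_zero]
    abel
  rw [hp₁, hq₁]
  have hac := congrArg (fun M => M.map Complex.ofReal) rac
  have hbd := congrArg (fun M => M.map Complex.ofReal) rbd
  have had := congrArg (fun M => M.map Complex.ofReal) rad
  have hda := congrArg (fun M => M.map Complex.ofReal) rda
  simp only [hsub, map_ofReal_mul, hone, transpose_map] at hac hbd had hda
  have hVb : ∀ s, ((x' s).map Complex.ofReal + Complex.I • (y' s).map Complex.ofReal).map
      (starRingEnd ℂ) = (x' s).map Complex.ofReal - Complex.I • (y' s).map Complex.ofReal :=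
    fun s => map_conj_add_I_smul _ _
  have hVV : ∀ s, ((x' s).map Complex.ofReal + Complex.I • (y' s).map Complex.ofReal) -
      ((x' s).map Complex.ofReal + Complex.I • (y' s).map Complex.ofReal).map (starRingEnd ℂ)
      = (2 * Complex.I) • (y' s).map Complex.ofReal := fun s => by
    rw [hVb, mul_smul, two_smul]
    abel
  have hVt : ∀ s, ((x' s).map Complex.ofReal + Complex.I • (y' s).map Complex.ofReal)ᵀ =
      (x' s).map Complex.ofReal + Complex.I • (y' s).map Complex.ofReal := fun s => by
    rw [transpose_add, transpose_smul, ← transpose_map, ← transpose_map, hx'symm, hy'symm]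
  have hdV : HasMDerivAt (fun s => (x' s).map Complex.ofReal + Complex.I • (y' s).map Complex.ofReal)
      ((mderiv x' t).map Complex.ofReal + Complex.I • (mderiv y' t).map Complex.ofReal) t :=
    (hasMDerivAt_mderiv hx' t).map_ofReal.add
      ((hasMDerivAt_mderiv hy' t).map_ofReal.const_smul Complex.I)
  have hdVb := map_conj_add_I_smul (mderiv x' t) (mderiv y' t)
  have hrhs := sjMetric_complex (α := α) (γ := γ) (dp := mderiv p' t) (dq := mderiv q' t)
    (hx'symm t) (hy'symm t) ((isUnit_iff_isUnit_det _).mp (hy'pd t).isUnit)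
    rfl (hVb t) rfl hdVb
  have hNconj : ∀ U : Matrix (Fin n) (Fin n) ℂ, (c.map Complex.ofReal * U
      + d.map Complex.ofReal).map (starRingEnd ℂ) =
      c.map Complex.ofReal * U.map (starRingEnd ℂ) + d.map Complex.ofReal := fun U => by
    rw [Matrix.map_add _ (map_add _), map_conj_mul, map_conj_ofReal, map_conj_ofReal]
  have hPconj : ∀ U : Matrix (Fin n) (Fin n) ℂ, (a.map Complex.ofReal * U
      + b.map Complex.ofReal).map (starRingEnd ℂ) =
      a.map Complex.ofReal * U.map (starRingEnd ℂ) + b.map Complex.ofReal := fun U => by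
    rw [Matrix.map_add _ (map_add _), map_conj_mul, map_conj_ofReal, map_conj_ofReal]
  have hVbt : ∀ s, (((x' s).map Complex.ofReal + Complex.I • (y' s).map Complex.ofReal).map
      (starRingEnd ℂ))ᵀ = ((x' s).map Complex.ofReal + Complex.I • (y' s).map Complex.ofReal).map
      (starRingEnd ℂ) := fun s => by rw [← transpose_map, hVt]
  have hN : ∀ s, IsUnit (c.map Complex.ofReal * ((x' s).map Complex.ofReal
      + Complex.I • (y' s).map Complex.ofReal) + d.map Complex.ofReal).det := fun s =>
    isUnit_det_automorphy (hy'pd s) (hNconj _).symm (hVV s)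
      (symplectic_pairing hac hbd had hda (hVbt s))
  have hdZ := hdV.moebius hac hbd had hda hVt hN
  rw [hdZ.map_re.mderiv_eq, hdZ.map_im.mderiv_eq]
  have hNb : IsUnit (c.map Complex.ofReal * ((x' t).map Complex.ofReal
      + Complex.I • (y' t).map Complex.ofReal).map (starRingEnd ℂ) + d.map Complex.ofReal).det := by
    rw [← hNconj]
    have := (RingHom.map_det (starRingEnd ℂ) (c.map Complex.ofReal * ((x' t).map Complex.ofReal
      + Complex.I • (y' t).map Complex.ofReal) + d.map Complex.ofReal)).symm
    exact (congrArg IsUnit this).mpr ((hN t).map _)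
  have hNt := hN t
  beta_reduce
  generalize (mderiv x' t).map Complex.ofReal + Complex.I • (mderiv y' t).map Complex.ofReal = dV
    at *
  have hVtt := hVt t
  have hVbtt := hVbt t
  have hVVt := hVV t
  generalize (x' t).map Complex.ofReal + Complex.I • (y' t).map Complex.ofReal = V at *
  have hZconj : ((a.map Complex.ofReal * V + b.map Complex.ofReal) *
      (c.map Complex.ofReal * V + d.map Complex.ofReal)⁻¹).map (starRingEnd ℂ) =
      (a.map Complex.ofReal * V.map (starRingEnd ℂ) + b.map Complex.ofReal) *
      (c.map Complex.ofReal * V.map (starRingEnd ℂ) + d.map Complex.ofReal)⁻¹ := by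
    rw [map_conj_mul, map_conj_inv hNt, hPconj, hNconj]
  have hdZconj : (((c.map Complex.ofReal * V + d.map Complex.ofReal)⁻¹)ᵀ * dV *
      (c.map Complex.ofReal * V + d.map Complex.ofReal)⁻¹).map (starRingEnd ℂ) =
      ((c.map Complex.ofReal * V.map (starRingEnd ℂ) + d.map Complex.ofReal)⁻¹)ᵀ *
      dV.map (starRingEnd ℂ) *
      (c.map Complex.ofReal * V.map (starRingEnd ℂ) + d.map Complex.ofReal)⁻¹ := by
    rw [map_conj_mul, map_conj_mul, transpose_map, map_conj_inv hNt, hNconj]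
  have hZt := moebius_transpose hac hbd had hda hVtt hNt
  have hrow := row_moebius (p := (mderiv p' t).map Complex.ofReal)
    (q := (mderiv q' t).map Complex.ofReal) hac hbd had hda hNt
  have hrowb := row_moebius (p := (mderiv p' t).map Complex.ofReal)
    (q := (mderiv q' t).map Complex.ofReal) hac hbd had hda hNb
  have hsub1 := moebius_sub hac hbd had hda hVtt hNt hNb
  have hsub2 := moebius_sub hac hbd had hda hVbtt hNb hNt
  rw [← hZconj] at hrowb hsub1 hsub2
  generalize (a.map Complex.ofReal * V + b.map Complex.ofReal) *
      (c.map Complex.ofReal * V + d.map Complex.ofReal)⁻¹ = Z at *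
  have h2I : (2 * Complex.I) ≠ 0 := by simp
  have hZZ : Z - Z.map (starRingEnd ℂ) =
      (2 * Complex.I) • (Z.map Complex.im).map Complex.ofReal := by
    rw [map_conj_eq_re_sub_im]
    nth_rw 1 [map_re_add_I_smul_map_im Z]
    rw [mul_smul, two_smul]
    abel
  rw [hZZ, hVVt, Matrix.mul_smul, Matrix.smul_mul] at hsub1
  rw [← neg_sub Z, hZZ, ← neg_sub V, hVVt, Matrix.mul_neg, Matrix.neg_mul, neg_inj,
    Matrix.mul_smul, Matrix.smul_mul] at hsub2
  have hY1 := smul_right_injective _ h2I hsub1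
  have hY2 := smul_right_injective _ h2I hsub2
  have hxt : (Z.map Complex.re)ᵀ = Z.map Complex.re := by rw [← transpose_map, hZt]
  have hyt : (Z.map Complex.im)ᵀ = Z.map Complex.im := by rw [← transpose_map, hZt]
  have hyu : IsUnit (Z.map Complex.im).det := by
    have hdet := congrArg det hY1
    rw [det_mul, det_mul] at hdet
    have hy0 : ((y' t).map Complex.ofReal).det ≠ 0 := by
      have := RingHom.map_det Complex.ofRealHom (y' t)
      intro h0
      exact (hy'pd t).det_pos.ne' (Complex.ofReal_injective (this.trans h0))
    rw [← hdet] at hy0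
    have h1 := right_ne_zero_of_mul (left_ne_zero_of_mul hy0)
    rw [isUnit_iff_ne_zero]
    intro h0
    have := RingHom.map_det Complex.ofRealHom (Z.map Complex.im)
    rw [h0, map_zero] at this
    exact h1 this.symm
  have hlhs := sjMetric_complex (α := α) (γ := γ)
    (dp := mderiv p' t * dᵀ - mderiv q' t * cᵀ) (dq := mderiv q' t * aᵀ - mderiv p' t * bᵀ)
    hxt hyt hyu (map_re_add_I_smul_map_im Z) (map_conj_eq_re_sub_im Z)
    (map_re_add_I_smul_map_im (((c.map Complex.ofReal * V + d.map Complex.ofReal)⁻¹)ᵀ * dV *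
      (c.map Complex.ofReal * V + d.map Complex.ofReal)⁻¹)) (map_conj_eq_re_sub_im _)
  have hsub' : ∀ M M' : Matrix (Fin 1) (Fin n) ℝ, (M - M').map Complex.ofReal =
      M.map Complex.ofReal - M'.map Complex.ofReal := fun M M' => by ext; simp
  rw [hsub', hsub', map_ofReal_mul, map_ofReal_mul, map_ofReal_mul, map_ofReal_mul,
    transpose_map, transpose_map, transpose_map, transpose_map, hrow, hrowb, hdZconj] at hlhs
  obtain ⟨htrace, hquad⟩ := complex_metric_congr (dV := dV) (dVb := dV.map (starRingEnd ℂ))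
    (w := (mderiv p' t).map Complex.ofReal * V + (mderiv q' t).map Complex.ofReal)
    (wb := (mderiv p' t).map Complex.ofReal * V.map (starRingEnd ℂ)
      + (mderiv q' t).map Complex.ofReal) hY1 hY2
  rw [htrace, hquad, ← hrhs] at hlhs
  exact Complex.ofReal_injective hlhs
end
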